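/- arXiv:2006.09825 — 6 statements merged into one kernel-verified Lean document; each statement's English description precedes it below -/
import Mathlib

section
/- For every a ∈ ℕ₀, every integer N ≥ 2 and every integer k ≥ 0, setting λ_N := 1/(N−1), one has | √(max(N−k, 0))/(N−1) − Σ_{ℓ=0}^{a} c_ℓ · λ_N^{ℓ} · √λ_N · (k−1)^ℓ | ≤ λ_N^{a+1} · √λ_N · 2^{a+1} · (k+1)^{a+1}. -/
/-- The Taylor coefficients `c_j^{(ℓ)} = (ℓ−1/2)(ℓ+1/2)⋯(ℓ+j−3/2)/j!` (with `c_0^{(ℓ)} = 1`). -/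
noncomputable def taylorCoeffC (ℓ j : ℕ) : ℝ :=
  (∏ i ∈ Finset.range j, ((ℓ : ℝ) - 1 / 2 + i)) / (Nat.factorial j)

open Polynomial in
theorem taylorCoeffC_zero_eq_choose (j : ℕ) :
    taylorCoeffC 0 j = (-1) ^ j * Ring.choose (1 / 2 : ℝ) j := by
  have h : ∀ n : ℕ, (descPochhammer ℤ n).smeval (1 / 2 : ℝ) =
      (-1) ^ n * ∏ i ∈ Finset.range n, (((0 : ℕ) : ℝ) - 1 / 2 + i) := by
    intro n
    induction n with
    | zero => simp
    | succ n ih =>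
      rw [descPochhammer_succ_right, smeval_mul, ih, Finset.prod_range_succ, smeval_sub,
        smeval_X, smeval_natCast]
      simp only [pow_one, pow_zero, nsmul_eq_mul, mul_one, Nat.cast_zero]
      ring
  rw [Ring.choose_eq_smul, h, taylorCoeffC, smul_eq_mul, mul_left_comm, ← mul_assoc ((-1) ^ j),
    ← mul_pow]
  simp [div_eq_inv_mul]

theorem sum_antidiagonal_taylorCoeffC_zero (n : ℕ) :
    ∑ p ∈ Finset.HasAntidiagonal.antidiagonal n, taylorCoeffC 0 p.1 * taylorCoeffC 0 p.2 =
      (-1) ^ n * (Nat.choose 1 n : ℝ) := by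
  have h := Ring.add_choose_eq n (Commute.all (1 / 2 : ℝ) (1 / 2))
  have h1 : (1 / 2 + 1 / 2 : ℝ) = ((1 : ℕ) : ℝ) := by norm_num
  rw [h1, Ring.choose_natCast] at h
  rw [h, Finset.mul_sum]
  refine Finset.sum_congr rfl fun p hp => ?_
  rw [taylorCoeffC_zero_eq_choose, taylorCoeffC_zero_eq_choose,
    ← Finset.HasAntidiagonal.mem_antidiagonal.mp hp, pow_add]
  ring

theorem taylorCoeffC_zero_zero : taylorCoeffC 0 0 = 1 := by
  simp [taylorCoeffC]

theorem taylorCoeffC_zero_succ_nonpos (j : ℕ) : taylorCoeffC 0 (j + 1) ≤ 0 := by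
  rw [taylorCoeffC, Finset.prod_range_succ']
  refine div_nonpos_of_nonpos_of_nonneg (mul_nonpos_of_nonneg_of_nonpos
    (Finset.prod_nonneg fun i _ => ?_) (by norm_num)) (by positivity)
  push_cast
  linarith [(Nat.cast_nonneg i : (0 : ℝ) ≤ i)]

theorem sum_taylorCoeffC_zero (a : ℕ) :
    ∑ ℓ ∈ Finset.range (a + 1), taylorCoeffC 0 ℓ = taylorCoeffC 1 a := by
  induction a with
  | zero => simp [taylorCoeffC]
  | succ a ih =>
    rw [Finset.sum_range_succ, ih, taylorCoeffC, taylorCoeffC, taylorCoeffC,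
      Finset.prod_range_succ', Finset.prod_range_succ, Nat.factorial_succ]
    have h : ∏ i ∈ Finset.range a, (((0 : ℕ) : ℝ) - 1 / 2 + ((i + 1 : ℕ) : ℝ)) =
        ∏ i ∈ Finset.range a, (((1 : ℕ) : ℝ) - 1 / 2 + i) :=
      Finset.prod_congr rfl fun i _ => by push_cast; ring
    rw [h]
    have : (a.factorial : ℝ) ≠ 0 := by positivity
    push_cast
    field_simp
    ring

theorem sum_taylorCoeffC_zero_pos (a : ℕ) :
    0 < ∑ ℓ ∈ Finset.range (a + 1), taylorCoeffC 0 ℓ := by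
  rw [sum_taylorCoeffC_zero, taylorCoeffC]
  refine div_pos (Finset.prod_pos fun i _ => ?_) (by positivity)
  push_cast
  linarith [(Nat.cast_nonneg i : (0 : ℝ) ≤ i)]

theorem sum_taylorCoeffC_zero_le_one (a : ℕ) :
    ∑ ℓ ∈ Finset.range (a + 1), taylorCoeffC 0 ℓ ≤ 1 := by
  rw [Finset.sum_range_succ', taylorCoeffC_zero_zero]
  linarith [Finset.sum_nonpos fun ℓ (_ : ℓ ∈ Finset.range a) => taylorCoeffC_zero_succ_nonpos ℓ]

theorem sum_abs_taylorCoeffC_zero_le_two (a : ℕ) :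
    ∑ ℓ ∈ Finset.range (a + 1), |taylorCoeffC 0 ℓ| ≤ 2 := by
  have h := sum_taylorCoeffC_zero_pos a
  rw [Finset.sum_range_succ', taylorCoeffC_zero_zero] at *
  simp only [abs_of_nonpos (taylorCoeffC_zero_succ_nonpos _), Finset.sum_neg_distrib, abs_one]
  linarith

theorem sum_taylorCoeffC_zero_le_sum_mul_pow (a : ℕ) {x : ℝ} (hx : |x| ≤ 1) :
    ∑ ℓ ∈ Finset.range (a + 1), taylorCoeffC 0 ℓ ≤
      ∑ ℓ ∈ Finset.range (a + 1), taylorCoeffC 0 ℓ * x ^ ℓ := by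
  refine Finset.sum_le_sum fun ℓ _ => ?_
  cases ℓ with
  | zero => simp
  | succ ℓ =>
    have h1 : x ^ (ℓ + 1) ≤ 1 :=
      (le_abs_self _).trans (by rw [abs_pow]; exact pow_le_one₀ (abs_nonneg x) hx)
    nlinarith [taylorCoeffC_zero_succ_nonpos ℓ]

open Polynomial in
theorem abs_eval_le_abs_pow_mul_eval_one {p : ℝ[X]} {m : ℕ} (hlow : ∀ n < m, p.coeff n = 0)
    (hnonneg : ∀ n, 0 ≤ p.coeff n) {x : ℝ} (hx : |x| ≤ 1) :
    |p.eval x| ≤ |x| ^ m * p.eval 1 := by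
  rw [eval_eq_sum_range, eval_eq_sum_range, Finset.mul_sum]
  refine (Finset.abs_sum_le_sum_abs _ _).trans (Finset.sum_le_sum fun n _ => ?_)
  rw [abs_mul, abs_of_nonneg (hnonneg n), abs_pow, one_pow, mul_one]
  rcases lt_or_ge n m with h | h
  · simp [hlow n h]
  · rw [mul_comm]
    exact mul_le_mul_of_nonneg_right (pow_le_pow_of_le_one (abs_nonneg x) hx h) (hnonneg n)

open Polynomial in
theorem abs_sq_sum_taylorCoeffC_zero_sub_le (a : ℕ) {x : ℝ} (hx : |x| ≤ 1) :
    |(∑ ℓ ∈ Finset.range (a + 1), taylorCoeffC 0 ℓ * x ^ ℓ) ^ 2 - (1 - x)| ≤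
      |x| ^ (a + 1) * (∑ ℓ ∈ Finset.range (a + 1), taylorCoeffC 0 ℓ) ^ 2 := by
  let p : ℝ[X] := ∑ ℓ ∈ Finset.range (a + 1), C (taylorCoeffC 0 ℓ) * X ^ ℓ
  have hp : ∀ n, p.coeff n = if n < a + 1 then taylorCoeffC 0 n else 0 := by
    intro n
    simp [p, finsetSum_coeff, coeff_C_mul, coeff_X_pow]
  have hlin : ∀ n, (1 - X : ℝ[X]).coeff n = (-1) ^ n * (Nat.choose 1 n : ℝ) := by
    rintro (_ | _ | n)
    · simp
    · simp [coeff_one]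
    · rw [coeff_sub, coeff_one, coeff_X, Nat.choose_eq_zero_of_lt (by omega)]
      simp
  have hlow : ∀ n < a + 1, (p * p - (1 - X)).coeff n = 0 := by
    intro n hn
    rw [coeff_sub, hlin, coeff_mul, ← sum_antidiagonal_taylorCoeffC_zero, sub_eq_zero]
    refine Finset.sum_congr rfl fun q hq => ?_
    have := Finset.HasAntidiagonal.mem_antidiagonal.mp hq
    rw [hp, hp, if_pos (by omega), if_pos (by omega)]
  have hnonneg : ∀ n, 0 ≤ (p * p - (1 - X)).coeff n := by
    intro n
    rcases lt_or_ge n (a + 1) with h | h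
    · exact (hlow n h).ge
    · rw [coeff_sub, sub_nonneg, coeff_mul]
      have hneg : (1 - X : ℝ[X]).coeff n ≤ 0 := by
        obtain ⟨m, rfl⟩ : ∃ m, n = m + 1 := ⟨n - 1, by omega⟩
        rw [coeff_sub, coeff_one, coeff_X, if_neg m.succ_ne_zero]
        split_ifs <;> norm_num
      refine hneg.trans (Finset.sum_nonneg fun q hq => ?_)
      have := Finset.HasAntidiagonal.mem_antidiagonal.mp hq
      rw [hp, hp]
      split_ifs with h1 h2
      · obtain ⟨i, hi⟩ : ∃ i, q.1 = i + 1 := ⟨q.1 - 1, by omega⟩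
        obtain ⟨j, hj⟩ : ∃ j, q.2 = j + 1 := ⟨q.2 - 1, by omega⟩
        rw [hi, hj]
        exact mul_nonneg_of_nonpos_of_nonpos (taylorCoeffC_zero_succ_nonpos i)
          (taylorCoeffC_zero_succ_nonpos j)
      all_goals simp
  have h := abs_eval_le_abs_pow_mul_eval_one hlow hnonneg hx
  simpa [p, eval_finsetSum, ← sq] using h

theorem abs_sqrt_one_sub_sub_sum_le (a : ℕ) {x : ℝ} (hx : |x| ≤ 1) :
    |√(1 - x) - ∑ ℓ ∈ Finset.range (a + 1), taylorCoeffC 0 ℓ * x ^ ℓ| ≤ |x| ^ (a + 1) := by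
  have hsq := abs_sq_sum_taylorCoeffC_zero_sub_le a hx
  have hpos := sum_taylorCoeffC_zero_pos a
  have hle := sum_taylorCoeffC_zero_le_one a
  have hlow := sum_taylorCoeffC_zero_le_sum_mul_pow a hx
  set s := ∑ ℓ ∈ Finset.range (a + 1), taylorCoeffC 0 ℓ * x ^ ℓ
  set t := ∑ ℓ ∈ Finset.range (a + 1), taylorCoeffC 0 ℓ
  have hroot : √(1 - x) ^ 2 = 1 - x := Real.sq_sqrt (by linarith [(abs_le.mp hx).2])
  have hroot0 := Real.sqrt_nonneg (1 - x)
  have hxa : 0 ≤ |x| ^ (a + 1) := by positivity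
  rw [← hroot, sq_sub_sq, abs_mul, abs_of_pos (by linarith : 0 < s + √(1 - x)),
    abs_sub_comm s] at hsq
  refine le_of_mul_le_mul_left ?_ hpos
  calc t * |√(1 - x) - s| ≤ (s + √(1 - x)) * |√(1 - x) - s| := by gcongr; linarith
    _ ≤ |x| ^ (a + 1) * t ^ 2 := hsq
    _ ≤ t * |x| ^ (a + 1) := by nlinarith [mul_nonneg hxa hpos.le]

theorem abs_sum_taylorCoeffC_zero_mul_pow_le (a : ℕ) {x : ℝ} (hx : 1 ≤ x) :
    |∑ ℓ ∈ Finset.range (a + 1), taylorCoeffC 0 ℓ * x ^ ℓ| ≤ 2 * x ^ a := by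
  have hx0 : 0 ≤ x := by linarith
  calc |∑ ℓ ∈ Finset.range (a + 1), taylorCoeffC 0 ℓ * x ^ ℓ|
      ≤ ∑ ℓ ∈ Finset.range (a + 1), |taylorCoeffC 0 ℓ| * x ^ a := by
        refine (Finset.abs_sum_le_sum_abs _ _).trans (Finset.sum_le_sum fun ℓ hℓ => ?_)
        rw [abs_mul, abs_of_nonneg (pow_nonneg hx0 ℓ)]
        gcongr
        have := Finset.mem_range.mp hℓ
        omega
    _ ≤ 2 * x ^ a := by
        rw [← Finset.sum_mul]
        gcongr
        exact sum_abs_taylorCoeffC_zero_le_two a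

theorem abs_sqrt_max_one_sub_sub_sum_le (a : ℕ) {x : ℝ} (hx : -1 ≤ x) :
    |√(max (1 - x) 0) - ∑ ℓ ∈ Finset.range (a + 1), taylorCoeffC 0 ℓ * x ^ ℓ| ≤
      (2 * |x|) ^ (a + 1) := by
  rcases le_total x 1 with h | h
  · rw [max_eq_left (by linarith)]
    refine (abs_sqrt_one_sub_sub_sum_le a (abs_le.mpr ⟨hx, h⟩)).trans ?_
    gcongr
    linarith [abs_nonneg x]
  · rw [max_eq_right (by linarith), Real.sqrt_zero, zero_sub, abs_neg,
      abs_of_nonneg (by linarith : 0 ≤ x), mul_pow]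
    refine (abs_sum_taylorCoeffC_zero_mul_pow_le a h).trans ?_
    gcongr
    · exact le_self_pow₀ one_le_two (Nat.succ_ne_zero a)
    · exact Nat.le_succ a

/-- Scalar form of the Taylor expansion of `√([N−𝒩]₊)/(N−1)` on the `k`-particle sector:
`|√(max(N−k,0))/(N−1) − Σ_{ℓ=0}^a c_ℓ λ_N^ℓ √λ_N (k−1)^ℓ| ≤ λ_N^{a+1} √λ_N 2^{a+1} (k+1)^{a+1}`
with `λ_N = 1/(N−1)`. -/
theorem sqrt_N_minus_k_taylor_remainder (a N k : ℕ) (hN : 2 ≤ N) :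
    |Real.sqrt (max ((N : ℝ) - k) 0) / ((N : ℝ) - 1) -
        ∑ ℓ ∈ Finset.range (a + 1),
          taylorCoeffC 0 ℓ * (1 / ((N : ℝ) - 1)) ^ ℓ * Real.sqrt (1 / ((N : ℝ) - 1)) *
            ((k : ℝ) - 1) ^ ℓ| ≤
      (1 / ((N : ℝ) - 1)) ^ (a + 1) * Real.sqrt (1 / ((N : ℝ) - 1)) * 2 ^ (a + 1) *
        ((k : ℝ) + 1) ^ (a + 1) := by
  have hN' : (2 : ℝ) ≤ N := by exact_mod_cast hN
  have hk : (0 : ℝ) ≤ k := Nat.cast_nonneg k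
  have hN1 : (N : ℝ) - 1 ≠ 0 := by linarith
  obtain ⟨r, hr⟩ : ∃ r : ℝ, r = 1 / ((N : ℝ) - 1) := ⟨_, rfl⟩
  have hr0 : 0 < r := hr ▸ one_div_pos.mpr (by linarith)
  have hr1 : r ≤ 1 := by rw [hr, div_le_one (by linarith)]; linarith
  have hrN : r * (N - 1) = 1 := by rw [hr, one_div, inv_mul_cancel₀ hN1]
  have hroot : √(max ((N : ℝ) - k) 0) / ((N : ℝ) - 1) = √r * √(max (1 - r * (k - 1)) 0) := by
    have hmax : max (1 - r * ((k : ℝ) - 1)) 0 = r * max ((N : ℝ) - k) 0 := by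
      rw [mul_max_of_nonneg _ _ hr0.le, mul_zero]
      congr 1
      linear_combination -hrN
    rw [hmax, Real.sqrt_mul hr0.le, ← mul_assoc, Real.mul_self_sqrt hr0.le, hr]
    ring
  have hsum : ∑ ℓ ∈ Finset.range (a + 1), taylorCoeffC 0 ℓ * r ^ ℓ * √r * ((k : ℝ) - 1) ^ ℓ =
      √r * ∑ ℓ ∈ Finset.range (a + 1), taylorCoeffC 0 ℓ * (r * (k - 1)) ^ ℓ := by
    rw [Finset.mul_sum]
    exact Finset.sum_congr rfl fun ℓ _ => by rw [mul_pow]; ring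
  rw [← hr, hroot, hsum, ← mul_sub, abs_mul, abs_of_nonneg (Real.sqrt_nonneg r)]
  have hx : -1 ≤ r * ((k : ℝ) - 1) := by nlinarith [mul_nonneg hr0.le hk]
  have habs : |(k : ℝ) - 1| ≤ k + 1 := abs_le.mpr ⟨by linarith, by linarith⟩
  calc √r * |√(max (1 - r * (k - 1)) 0) -
        ∑ ℓ ∈ Finset.range (a + 1), taylorCoeffC 0 ℓ * (r * (k - 1)) ^ ℓ|
      ≤ √r * (2 * |r * ((k : ℝ) - 1)|) ^ (a + 1) := by
        gcongr
        exact abs_sqrt_max_one_sub_sub_sum_le a hx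
    _ ≤ √r * (2 * (r * (k + 1))) ^ (a + 1) := by
        rw [abs_mul, abs_of_pos hr0]
        gcongr
    _ = r ^ (a + 1) * √r * 2 ^ (a + 1) * ((k : ℝ) + 1) ^ (a + 1) := by
        rw [mul_pow, mul_pow]
        ring
end

section
/- Let A be a unital associative ℂ-algebra (not necessarily commutative), let a ∈ ℕ₀ and t ∈ ℂ. Let H₀, H⁺ ∈ A, let H_j ∈ A for 1 ≤ j ≤ a, and let R_ν ∈ A for 0 ≤ ν ≤ a satisfy R_ν = H_{ν+1} + t·R_{ν+1} for all 0 ≤ ν ≤ a−1. Set H⁻ := H₀ + t·R₀ and H := H⁻ + H⁺. Let z ∈ ℂ be such that z·1 − H, z·1 − H₀ and z·1 − H⁻ are invertible in A, with inverses G, G₀ and G⁻ respectively. Define T₀ := 1 and, for 1 ≤ ℓ ≤ a, T_ℓ := Σ_{ν=1}^{ℓ} Σ_{(j₁,…,j_ν) a composition of ℓ} H_{j₁}·G₀·H_{j₂}·G₀ ⋯ H_{j_ν}·G₀, and set S_a := Σ_{ν=0}^{a} R_ν·G₀·T_{a−ν}. Then G = G₀·(Σ_{ℓ=0}^{a} t^ℓ·T_ℓ)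 + t^{a+1}·G⁻·S_a + G⁻·H⁺·G. -/
/-- The composition of `n + 1` obtained from one of `n - j` by prepending the block `j + 1`. -/
def Composition.consBlock {n : ℕ} (j : Fin (n + 1)) (c : Composition (n - j)) :
    Composition (n + 1) where
  blocks := (j + 1 : ℕ) :: c.blocks
  blocks_pos := by
    intro i hi
    rcases List.mem_cons.1 hi with rfl | hi
    · exact Nat.succ_pos _
    · exact c.blocks_pos hi
  blocks_sum := by
    rw [List.sum_cons, c.blocks_sum]
    omega

theorem Composition.sum_blocks_succ {M : Type*} [AddCommMonoid M] (n : ℕ) (f : List ℕ → M) :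
    ∑ c : Composition (n + 1), f c.blocks =
      ∑ j ∈ Finset.range (n + 1), ∑ c : Composition (n - j), f ((j + 1) :: c.blocks) := by
  rw [Finset.sum_range (fun j => ∑ c : Composition (n - j), f ((j + 1) :: c.blocks)),
    ← Fintype.sum_sigma' (fun (j : Fin (n + 1)) (c : Composition (n - j)) =>
      f ((j + 1 : ℕ) :: c.blocks))]
  symm
  refine Fintype.sum_bijective
    (fun x : (j : Fin (n + 1)) × Composition (n - j) => Composition.consBlock x.1 x.2)
    ⟨?_, ?_⟩ _ _ (fun _ => rfl)
  · rintro ⟨j, c⟩ ⟨k, d⟩ h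
    obtain ⟨h₁, h₂⟩ := List.cons.inj (congrArg Composition.blocks h)
    obtain rfl : j = k := Fin.ext (Nat.succ_injective h₁)
    exact congrArg (Sigma.mk j) (Composition.ext h₂)
  · rintro ⟨_ | ⟨b, l⟩, hpos, hsum⟩
    · simp at hsum
    · have hb : 0 < b := hpos (by simp)
      rw [List.sum_cons] at hsum
      refine ⟨⟨⟨b - 1, by omega⟩, ⟨l, fun hi => hpos (List.mem_cons_of_mem _ hi), ?_⟩⟩, ?_⟩
      · simp only
        omega
      · apply Composition.ext
        simp only [Composition.consBlock]
        rw [Nat.sub_add_cancel hb]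

theorem Composition.sum_Icc_length {M : Type*} [AddCommMonoid M] {n : ℕ} (hn : n ≠ 0)
    (f : Composition n → M) :
    ∑ ν ∈ Finset.Icc 1 n, ∑ c ∈ Finset.univ.filter (fun c : Composition n => c.length = ν), f c =
      ∑ c, f c :=
  Finset.sum_fiberwise_of_maps_to (fun c _ => Finset.mem_Icc.2
    ⟨c.length_pos_of_pos (Nat.pos_of_ne_zero hn), c.length_le⟩) f

/-- The sum over all compositions `c` of `n` of the product of `x j` over the blocks `j` of `c`. -/
def compositionSum {A : Type*} [Semiring A] (x : ℕ → A) (n : ℕ) : A :=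
  ∑ c : Composition n, (c.blocks.map x).prod

theorem compositionSum_zero {A : Type*} [Semiring A] (x : ℕ → A) : compositionSum x 0 = 1 := by
  have h (c : Composition 0) : c.blocks = [] := c.blocks_eq_nil.2 rfl
  simp [compositionSum, h, composition_card]

theorem compositionSum_succ {A : Type*} [Semiring A] (x : ℕ → A) (n : ℕ) :
    compositionSum x (n + 1) =
      ∑ j ∈ Finset.range (n + 1), x (j + 1) * compositionSum x (n - j) := by
  simp only [compositionSum, Composition.sum_blocks_succ n (fun l => (l.map x).prod),
    List.map_cons, List.prod_cons, Finset.mul_sum]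

theorem compositionSum_eq_ite {A : Type*} [Semiring A] (x : ℕ → A) (n : ℕ) :
    (if n = 0 then 1 else ∑ ν ∈ Finset.Icc 1 n,
      ∑ c ∈ Finset.univ.filter (fun c : Composition n => c.length = ν), (c.blocks.map x).prod) =
      compositionSum x n := by
  split_ifs with hn
  · rw [hn, compositionSum_zero]
  · exact Composition.sum_Icc_length hn _

/-- Second resolvent identity, for inverses of arbitrary ring elements. -/
theorem sub_eq_mul_sub_mul_of_inverses {A : Type*} [Ring A] {x y u v : A}
    (hu : u * x = 1) (hv : y * v = 1) : v - u = u * (x - y) * v := by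
  rw [mul_sub, sub_mul, hu, one_mul, mul_assoc, hv, mul_one]

/-- Iterating `K = G₀ + t K R₀ G₀` along `R_ν = H_{ν+1} + t R_{ν+1}`. -/
theorem perturbation_expansion {𝕜 A : Type*} [CommRing 𝕜] [Ring A] [Algebra 𝕜 A] (t : 𝕜)
    (H R : ℕ → A) (G₀ K : A) (hK : K = G₀ + t • (K * R 0 * G₀)) (a : ℕ)
    (hR : ∀ ν < a, R ν = H (ν + 1) + t • R (ν + 1)) :
    K = G₀ * (∑ ℓ ∈ Finset.range (a + 1), t ^ ℓ • compositionSum (fun j => H j * G₀) ℓ) +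
      t ^ (a + 1) • (K * ∑ ν ∈ Finset.range (a + 1),
        R ν * G₀ * compositionSum (fun j => H j * G₀) (a - ν)) := by
  induction a with
  | zero => simpa [compositionSum_zero, mul_assoc] using hK
  | succ a ih =>
    have key : K * ∑ ν ∈ Finset.range (a + 1),
          R ν * G₀ * compositionSum (fun j => H j * G₀) (a - ν) =
        G₀ * compositionSum (fun j => H j * G₀) (a + 1) +
          t • (K * ∑ ν ∈ Finset.range (a + 1 + 1),
            R ν * G₀ * compositionSum (fun j => H j * G₀) (a + 1 - ν)) := by
      have hS : ∑ ν ∈ Finset.range (a + 1),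
            R ν * G₀ * compositionSum (fun j => H j * G₀) (a - ν) =
          compositionSum (fun j => H j * G₀) (a + 1) + t • ∑ ν ∈ Finset.range (a + 1),
            R (ν + 1) * G₀ * compositionSum (fun j => H j * G₀) (a - ν) := by
        rw [compositionSum_succ, Finset.smul_sum, ← Finset.sum_add_distrib]
        refine Finset.sum_congr rfl fun ν hν => ?_
        rw [hR ν (Finset.mem_range.1 hν), add_mul, add_mul, smul_mul_assoc, smul_mul_assoc]
      rw [Finset.sum_range_succ' _ (a + 1), hS]
      simp only [Nat.add_sub_add_right, Nat.sub_zero]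
      have hK' := congrArg (· * compositionSum (fun j => H j * G₀) (a + 1)) hK
      simp only [add_mul, smul_mul_assoc, mul_assoc] at hK'
      simp only [mul_add, mul_smul_comm, smul_add, mul_assoc]
      rw [hK']
      abel
    conv_lhs => rw [ih fun ν hν => hR ν (hν.trans a.lt_succ_self), key]
    rw [Finset.sum_range_succ (fun ℓ => t ^ ℓ • _) (a + 1), mul_add, mul_smul_comm, smul_add, smul_smul, ← pow_succ,
      ← add_assoc]


/-- Abstract resolvent expansion: if `R_ν = H_{ν+1} + t·R_{ν+1}` for `0 ≤ ν ≤ a−1`,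
`H⁻ = H₀ + t·R₀`, `H = H⁻ + H⁺`, and `G, G₀, G⁻` are two-sided inverses of
`z·1 − H`, `z·1 − H₀`, `z·1 − H⁻` respectively, then
`G = G₀·Σ_{ℓ=0}^a t^ℓ T_ℓ + t^{a+1} G⁻·S_a + G⁻·H⁺·G`, where `T_ℓ` is the sum over
compositions `(j₁,…,j_ν)` of `ℓ` of `H_{j₁}G₀ ⋯ H_{j_ν}G₀` (with `T₀ = 1`) and
`S_a = Σ_{ν=0}^a R_ν G₀ T_{a−ν}`. -/
theorem resolvent_expansion
    {A : Type*} [Ring A] [Algebra ℂ A] (a : ℕ) (t : ℂ)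
    (H₀ Hplus : A) (H : ℕ → A) (R : ℕ → A)
    (hR : ∀ ν : ℕ, ν < a → R ν = H (ν + 1) + t • R (ν + 1))
    (z : ℂ) (G G₀ Gm : A)
    (hG : (z • (1 : A) - (H₀ + t • R 0 + Hplus)) * G = 1 ∧
          G * (z • (1 : A) - (H₀ + t • R 0 + Hplus)) = 1)
    (hG₀ : (z • (1 : A) - H₀) * G₀ = 1 ∧ G₀ * (z • (1 : A) - H₀) = 1)
    (hGm : (z • (1 : A) - (H₀ + t • R 0)) * Gm = 1 ∧
           Gm * (z • (1 : A) - (H₀ + t • R 0)) = 1) :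
    G = G₀ *
          (∑ ℓ ∈ Finset.range (a + 1), t ^ ℓ •
            (if ℓ = 0 then 1 else
              ∑ ν ∈ Finset.Icc 1 ℓ,
                ∑ c ∈ Finset.univ.filter (fun c : Composition ℓ => c.length = ν),
                  (c.blocks.map (fun j => H j * G₀)).prod)) +
        t ^ (a + 1) •
          (Gm * ∑ ν ∈ Finset.range (a + 1), R ν * G₀ *
            (if a - ν = 0 then 1 else
              ∑ μ ∈ Finset.Icc 1 (a - ν),
                ∑ c ∈ Finset.univ.filter (fun c : Composition (a - ν) => c.length = μ),
                  (c.blocks.map (fun j => H j * G₀)).prod)) +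
        Gm * Hplus * G := by
  simp only [compositionSum_eq_ite (fun j => H j * G₀)]
  have hK : Gm = G₀ + t • (Gm * R 0 * G₀) := by
    have h := sub_eq_mul_sub_mul_of_inverses hGm.2 hG₀.1
    rw [sub_sub_sub_cancel_left, sub_add_cancel_left, mul_neg, neg_mul, mul_smul_comm,
      smul_mul_assoc] at h
    rw [← sub_eq_iff_eq_add', ← neg_sub, h, neg_neg]
  have hGK : G = Gm + Gm * Hplus * G := by
    have h := sub_eq_mul_sub_mul_of_inverses hGm.2 hG.1
    rwa [sub_sub_sub_cancel_left, add_sub_cancel_left, sub_eq_iff_eq_add'] at h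
  rw [← perturbation_expansion t H R G₀ Gm hK a hR]
  exact hGK
end

section
/- Let H be a complex Hilbert space. For every ε > 0 let P(ε) be a bounded linear operator on H with P(ε)∘P(ε) = P(ε), and let (P_ℓ)_{ℓ∈ℕ₀} be bounded linear operators on H, independent of ε, such that for every a ∈ ℕ₀ there exist a constant C(a) > 0 and ε_a > 0 with ‖P(ε) − Σ_{ℓ=0}^{a} ε^ℓ·P_ℓ‖_op ≤ C(a)·ε^{a+1} for all 0 < ε ≤ ε_a. Then for every ℓ ∈ ℕ₀, P_ℓ = Σ_{j=0}^{ℓ} P_j ∘ P_{ℓ−j}. -/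
open Filter Topology Asymptotics Finset in
/-- The coefficients of an asymptotic expansion at `0⁺` are unique. -/
theorem asymptoticExpansion_unique {E : Type*} [NormedAddCommGroup E] [NormedSpace ℝ E]
    {f : ℝ → E} {c d : ℕ → E}
    (hc : ∀ n, (fun ε ↦ f ε - ∑ k ∈ range n, ε ^ k • c k) =O[𝓝[>] 0] fun ε : ℝ ↦ ε ^ n)
    (hd : ∀ n, (fun ε ↦ f ε - ∑ k ∈ range n, ε ^ k • d k) =O[𝓝[>] 0] fun ε : ℝ ↦ ε ^ n)
    (n : ℕ) : c n = d n := by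
  induction n using Nat.strong_induction_on with
  | _ n ih =>
    have hdiff : (fun ε : ℝ ↦ ε ^ n • (d n - c n)) =O[𝓝[>] 0] fun ε : ℝ ↦ ε ^ (n + 1) := by
      refine ((hc (n + 1)).sub (hd (n + 1))).congr_left fun ε ↦ ?_
      have hlow : ∑ k ∈ range n, ε ^ k • c k = ∑ k ∈ range n, ε ^ k • d k :=
        sum_congr rfl fun k hk ↦ by rw [ih k (mem_range.mp hk)]
      rw [sum_range_succ, sum_range_succ, hlow, smul_sub]
      abel
    have hconst : (fun _ : ℝ ↦ d n - c n) =O[𝓝[>] 0] fun ε : ℝ ↦ ε := by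
      have hinv := (isBigO_refl (fun ε : ℝ ↦ (ε ^ n)⁻¹) (𝓝[>] 0)).smul hdiff
      refine hinv.congr' ?_ ?_ <;> filter_upwards [self_mem_nhdsWithin] with ε hε
      · rw [smul_smul, inv_mul_cancel₀ (pow_ne_zero n (ne_of_gt hε)), one_smul]
      · rw [smul_eq_mul, pow_succ, inv_mul_cancel_left₀ (pow_ne_zero n (ne_of_gt hε))]
    have hlim : Tendsto (fun _ : ℝ ↦ d n - c n) (𝓝[>] 0) (𝓝 0) :=
      hconst.trans_tendsto (tendsto_nhdsWithin_of_tendsto_nhds tendsto_id)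
    exact (sub_eq_zero.mp (tendsto_nhds_unique tendsto_const_nhds hlim)).symm

open Filter Topology Asymptotics Finset in
/-- Asymptotic expansions multiply by convolution of their coefficients. -/
theorem asymptoticExpansion_mul {A : Type*} [NormedRing A] [NormedAlgebra ℝ A] {l : Filter ℝ}
    {f g : ℝ → A} {c d : ℕ → A}
    (hf : ∀ n, (fun ε ↦ f ε - ∑ k ∈ range n, ε ^ k • c k) =O[l] fun ε : ℝ ↦ ε ^ n)
    (hg : ∀ n, (fun ε ↦ g ε - ∑ k ∈ range n, ε ^ k • d k) =O[l] fun ε : ℝ ↦ ε ^ n)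
    (n : ℕ) :
    (fun ε ↦ f ε * g ε - ∑ k ∈ range n, ε ^ k • ∑ j ∈ range (k + 1), c j * d (k - j))
      =O[l] fun ε : ℝ ↦ ε ^ n := by
  have hgbdd : g =O[l] fun _ ↦ (1 : ℝ) := by simpa using hg 0
  have hleft : (fun ε ↦ (f ε - ∑ k ∈ range n, ε ^ k • c k) * g ε) =O[l] fun ε : ℝ ↦ ε ^ n := by
    simpa using (hf n).mul hgbdd
  have hright : (fun ε ↦ ∑ i ∈ range n,
      ε ^ i • (c i * (g ε - ∑ j ∈ range (n - i), ε ^ j • d j))) =O[l] fun ε : ℝ ↦ ε ^ n := by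
    refine IsBigO.fun_sum fun i hi ↦ ?_
    refine ((isBigO_refl (fun ε : ℝ ↦ ε ^ i) l).smul
      ((hg (n - i)).const_mul_left (c i))).congr_right fun ε ↦ ?_
    rw [smul_eq_mul, ← pow_add, Nat.add_sub_cancel' (mem_range.mp hi).le]
  refine (hleft.add hright).congr_left fun ε ↦ ?_
  have hconv : ∑ k ∈ range n, ε ^ k • ∑ j ∈ range (k + 1), c j * d (k - j) =
      ∑ i ∈ range n, ε ^ i • (c i * ∑ j ∈ range (n - i), ε ^ j • d j) := by
    have hflip := sum_range_diag_flip n fun i j ↦ ε ^ (i + j) • (c i * d j)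
    simp only [mul_sum, smul_sum, mul_smul_comm, smul_smul, ← pow_add]
    rw [← hflip]
    refine sum_congr rfl fun k _ ↦ sum_congr rfl fun j hj ↦ ?_
    rw [Nat.add_sub_cancel' (Nat.lt_succ_iff.mp (mem_range.mp hj))]
  rw [hconv]
  simp only [mul_sub, smul_sub, sum_sub_distrib, sub_mul, sum_mul, smul_mul_assoc]
  abel


/-- If a family of idempotents `P(ε)` on a complex Hilbert space admits an asymptotic
expansion `P(ε) = Σ_{ℓ=0}^a ε^ℓ P_ℓ + O(ε^{a+1})` in operator norm, to every order `a`,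
then the coefficients satisfy the convolution identity `P_ℓ = Σ_{j=0}^ℓ P_j ∘ P_{ℓ−j}`. -/
theorem idempotent_expansion_convolution
    {H : Type*} [NormedAddCommGroup H] [InnerProductSpace ℂ H] [CompleteSpace H]
    (P : ℝ → H →L[ℂ] H) (hidem : ∀ ε : ℝ, 0 < ε → P ε ∘L P ε = P ε)
    (Pc : ℕ → H →L[ℂ] H)
    (hexp : ∀ a : ℕ, ∃ C : ℝ, 0 < C ∧ ∃ εa : ℝ, 0 < εa ∧
      ∀ ε : ℝ, 0 < ε → ε ≤ εa →
        ‖P ε - ∑ ℓ ∈ Finset.range (a + 1), ε ^ ℓ • Pc ℓ‖ ≤ C * ε ^ (a + 1)) :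
    ∀ ℓ : ℕ, Pc ℓ = ∑ j ∈ Finset.range (ℓ + 1), Pc j ∘L Pc (ℓ - j) := by
  open Filter Topology Asymptotics Finset in
  have hpos (a : ℕ) : (fun ε ↦ P ε - ∑ k ∈ range (a + 1), ε ^ k • Pc k)
      =O[𝓝[>] 0] fun ε : ℝ ↦ ε ^ (a + 1) := by
    obtain ⟨C, -, εa, hεa, h⟩ := hexp a
    refine IsBigO.of_bound C ?_
    filter_upwards [Ioc_mem_nhdsGT hεa] with ε hε
    rw [Real.norm_of_nonneg (pow_nonneg hε.1.le _)]
    exact h ε hε.1 hε.2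
  open Filter Topology Asymptotics Finset in
  have hP : ∀ n, (fun ε ↦ P ε - ∑ k ∈ range n, ε ^ k • Pc k)
      =O[𝓝[>] 0] fun ε : ℝ ↦ ε ^ n := by
    rintro (_ | a)
    · have hsmall : (fun ε : ℝ ↦ ε ^ (0 + 1)) =O[𝓝[>] 0] fun _ ↦ (1 : ℝ) :=
        ((continuous_pow (0 + 1)).tendsto 0).mono_left nhdsWithin_le_nhds |>.isBigO_one ℝ
      simpa using ((hpos 0).trans hsmall).add (isBigO_const_const (Pc 0) one_ne_zero _)
    · exact hpos a
  refine asymptoticExpansion_unique hP fun n ↦ (asymptoticExpansion_mul hP hP n).congr' ?_ .rfl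
  filter_upwards [self_mem_nhdsWithin] with ε hε
  have hmul : P ε * P ε = P ε := hidem ε hε
  rw [hmul]
  rfl
end

section
/- Let H be a complex Hilbert space. For every ε > 0 let χ(ε) ∈ H be a unit vector and let P(ε) := ⟨χ(ε), ·⟩·χ(ε) be the orthogonal projection onto ℂ·χ(ε). Let χ₀ ∈ H be a unit vector, P₀ := ⟨χ₀, ·⟩·χ₀, and let (P_ℓ)_{ℓ≥1} be bounded linear operators on H, independent of ε, such that for every a ∈ ℕ₀ there exist C(a) > 0 and ε_a > 0 with ‖P(ε) − Σ_{ℓ=0}^{a} ε^ℓ·P_ℓ‖_op ≤ C(a)·ε^{a+1} for all 0 < ε ≤ ε_a. Define χ̃₀ := χ₀ and, for ℓ ≥ 1, χ̃_ℓ := Σ_{ν=1}^{ℓ} Σ_{(j₁,…,j_ν) a composition of ℓ} P_{j₁}P_{j₂}⋯P_{j_ν}χ₀; define α₀ := 1 and, recursively for ℓ ≥ 1, α_ℓ := −(1/2) Σ_{(j₁,j₂,j₃,j₄) ∈ ℕ₀⁴, j₁<ℓ, j₂<ℓ, j₁+j₂+j₃+j₄=ℓ} α_{j₁}·α_{j₂}·⟨χ̃_{j₃},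 χ̃_{j₄}⟩ (these numbers are real); and set χ_ℓ := Σ_{j=0}^{ℓ} α_j·χ̃_{ℓ−j}. Then for every a ∈ ℕ₀ there exist a constant C̃(a) > 0 and ε′_a > 0 such that for every 0 < ε ≤ ε′_a there is θ ∈ ℂ with |θ| = 1 and ‖θ·χ(ε) − Σ_{ℓ=0}^{a} ε^ℓ·χ_ℓ‖ ≤ C̃(a)·ε^{a+1}. -/
open scoped InnerProductSpace
open Filter Topology Asymptotics Finset

/-- The asymptotic expansion `f ε = ∑ i < n, ε ^ i • c i + O(ε ^ n)` as `ε ↓ 0`. -/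
def HasExpansion {E : Type*} [NormedAddCommGroup E] [NormedSpace ℝ E]
    (n : ℕ) (f : ℝ → E) (c : ℕ → E) : Prop :=
  (fun ε => f ε - ∑ i ∈ range n, ε ^ i • c i) =O[𝓝[>] (0 : ℝ)] fun ε => ε ^ n

namespace HasExpansion

variable {E F G : Type*} [NormedAddCommGroup E] [NormedSpace ℝ E]
  [NormedAddCommGroup F] [NormedSpace ℝ F] [NormedAddCommGroup G] [NormedSpace ℝ G]
  {n : ℕ} {f g : ℝ → E} {c d : ℕ → E}

lemma zero_iff : HasExpansion 0 f c ↔ f =O[𝓝[>] (0 : ℝ)] fun _ => (1 : ℝ) := by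
  simp [HasExpansion]

lemma succ_iff : HasExpansion (n + 1) f c ↔
    HasExpansion n (fun ε => ε⁻¹ • (f ε - c 0)) fun i => c (i + 1) := by
  have hpos : ∀ᶠ ε in 𝓝[>] (0 : ℝ), 0 < ε := self_mem_nhdsWithin
  have key : ∀ᶠ ε in 𝓝[>] (0 : ℝ), f ε - ∑ i ∈ range (n + 1), ε ^ i • c i =
      ε • (ε⁻¹ • (f ε - c 0) - ∑ i ∈ range n, ε ^ i • c (i + 1)) := by
    filter_upwards [hpos] with ε hε
    rw [sum_range_succ', smul_sub, smul_inv_smul₀ hε.ne', smul_sum]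
    simp only [smul_smul, pow_succ', pow_zero, one_smul]
    abel
  unfold HasExpansion
  rw [isBigO_congr key (Eventually.of_forall fun ε => pow_succ' ε n)]
  constructor
  · intro h
    refine ((isBigO_refl (fun ε : ℝ => ε⁻¹) _).smul h).congr' ?_ ?_
    · filter_upwards [hpos] with ε hε
      rw [inv_smul_smul₀ hε.ne']
    · filter_upwards [hpos] with ε hε
      rw [smul_eq_mul, inv_mul_cancel_left₀ hε.ne']
  · exact fun h => (isBigO_refl (fun ε : ℝ => ε) _).smul h

lemma congr (hf : HasExpansion n f c) (h : f =ᶠ[𝓝[>] (0 : ℝ)] g) (hcd : ∀ i, c i = d i) :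
    HasExpansion n g d := by
  obtain rfl : c = d := funext hcd
  exact IsBigO.congr' hf (by filter_upwards [h] with ε hε; rw [hε]) .rfl

lemma of_succ (hf : HasExpansion (n + 1) f c) : HasExpansion n f c := by
  have h1 : (fun ε : ℝ => ε ^ (n + 1)) =O[𝓝[>] (0 : ℝ)] fun ε => ε ^ n :=
    IsBigO.of_bound 1 (by
      filter_upwards [Ioo_mem_nhdsGT one_pos] with ε hε
      rw [one_mul, norm_pow, norm_pow]
      exact pow_le_pow_of_le_one (norm_nonneg _)
        (by simpa [abs_of_pos hε.1] using hε.2.le) n.le_succ)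
  have h2 : (fun ε : ℝ => ε ^ n • c n) =O[𝓝[>] (0 : ℝ)] fun ε => ε ^ n := by
    simpa using (isBigO_refl (fun ε : ℝ => ε ^ n) (𝓝[>] (0 : ℝ))).smul
      (isBigO_const_const (c n) (one_ne_zero (α := ℝ)) _)
  refine ((IsBigO.trans hf h1).add h2).congr_left fun ε => ?_
  rw [sum_range_succ]
  abel

lemma isBigO_one (hf : HasExpansion n f c) : f =O[𝓝[>] (0 : ℝ)] fun _ => (1 : ℝ) := by
  induction n with
  | zero => exact zero_iff.1 hf
  | succ n ih => exact ih hf.of_succ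

lemma tendsto (hf : HasExpansion (n + 1) f c) : Tendsto f (𝓝[>] 0) (𝓝 (c 0)) := by
  have h := ((isBigO_refl (fun ε : ℝ => ε) (𝓝[>] (0 : ℝ))).smul
    (succ_iff.1 hf).isBigO_one).trans_tendsto (by
      simp only [smul_eq_mul, mul_one]
      exact tendsto_id.mono_left nhdsWithin_le_nhds)
  rw [tendsto_iff_norm_sub_tendsto_zero, ← tendsto_zero_iff_norm_tendsto_zero]
  refine h.congr' ?_
  filter_upwards [self_mem_nhdsWithin] with ε hε
  exact smul_inv_smul₀ (ne_of_gt hε) _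

lemma add (hf : HasExpansion n f c) (hg : HasExpansion n g d) :
    HasExpansion n (fun ε => f ε + g ε) fun i => c i + d i := by
  refine (IsBigO.add hf hg).congr_left fun ε => ?_
  simp only [smul_add, sum_add_distrib]
  abel

lemma map (L : E →L[ℝ] F) (hf : HasExpansion n f c) :
    HasExpansion n (fun ε => L (f ε)) fun i => L (c i) := by
  refine ((L.isBigO_comp _ _).trans hf).congr_left fun ε => ?_
  simp

/-- Cauchy product of asymptotic expansions. -/
lemma bilin (B : E →L[ℝ] F →L[ℝ] G) {g : ℝ → F} {d : ℕ → F}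
    (hf : HasExpansion n f c) (hg : HasExpansion n g d) :
    HasExpansion n (fun ε => B (f ε) (g ε)) fun m => ∑ p ∈ antidiagonal m, B (c p.1) (d p.2) := by
  induction n generalizing f g c d with
  | zero =>
    rw [zero_iff] at *
    have h : (fun ε => B (f ε) (g ε)) =O[𝓝[>] (0 : ℝ)] fun ε => ‖f ε‖ * ‖g ε‖ :=
      IsBigO.of_bound ‖B‖ (Eventually.of_forall fun ε => by
        simpa [mul_assoc] using B.le_opNorm₂ (f ε) (g ε))
    simpa using h.trans (hf.norm_left.mul hg.norm_left)
  | succ n ih =>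
    rw [succ_iff]
    refine (((succ_iff.1 hg).map (B (c 0))).add (ih (succ_iff.1 hf) hg.of_succ)).congr ?_ ?_
    · refine Eventually.of_forall fun ε => ?_
      simp only [Nat.antidiagonal_zero, sum_singleton, map_smul, map_sub,
        _root_.smul_apply, _root_.sub_apply, ← smul_add]
      congr 1
      abel
    · intro m
      rw [Nat.sum_antidiagonal_succ]

lemma polynomial (n : ℕ) (c : ℕ → E) :
    HasExpansion n (fun ε => ∑ i ∈ range n, ε ^ i • c i) c := by
  simpa [HasExpansion] using isBigO_zero _ _

end HasExpansion

/-- Sums over compositions of `n + 1` decompose according to the first block. -/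
lemma Composition.sum_prod_map_blocks_succ {R : Type*} [Semiring R] (f : ℕ → R) (n : ℕ) :
    ∑ c : Composition (n + 1), (c.blocks.map f).prod =
      ∑ p ∈ antidiagonal n, f (p.1 + 1) * ∑ c : Composition p.2, (c.blocks.map f).prod := by
  simp_rw [mul_sum]
  rw [sum_sigma']
  symm
  refine sum_bij (fun x hx => ⟨(x.1.1 + 1) :: x.2.blocks, ?_, ?_⟩) ?_ ?_ ?_ ?_
  · intro i hi
    rcases List.mem_cons.1 hi with rfl | hi
    · omega
    · exact x.2.blocks_pos hi
  · have := mem_antidiagonal.1 (mem_sigma.1 hx).1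
    rw [List.sum_cons, x.2.blocks_sum]
    omega
  · simp
  · rintro ⟨⟨i, j⟩, c⟩ hx ⟨⟨i', j'⟩, c'⟩ hx' h
    have h1 := mem_antidiagonal.1 (mem_sigma.1 hx).1
    have h2 := mem_antidiagonal.1 (mem_sigma.1 hx').1
    simp only [Composition.mk.injEq, List.cons.injEq] at h h1 h2
    obtain rfl : i = i' := by omega
    obtain rfl : j = j' := by omega
    obtain rfl : c = c' := Composition.ext h.2
    rfl
  · rintro ⟨b, hb, hs⟩ -
    cases b with
    | nil => simp at hs
    | cons k b =>
      have hk : 0 < k := hb (by simp)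
      rw [List.sum_cons] at hs
      refine ⟨⟨(k - 1, b.sum), ⟨b, fun hi => hb (List.mem_cons_of_mem _ hi), rfl⟩⟩, ?_, ?_⟩
      · simp
        omega
      · ext1
        simp only [List.cons.injEq, and_true]
        omega
  · rintro ⟨⟨i, j⟩, c⟩ hx
    simp

lemma Finset.Nat.sum_antidiagonalTuple_succ {M : Type*} [AddCommMonoid M] (k n : ℕ)
    (f : (Fin (k + 1) → ℕ) → M) :
    ∑ j ∈ Nat.antidiagonalTuple (k + 1) n, f j =
      ∑ p ∈ antidiagonal n, ∑ j ∈ Nat.antidiagonalTuple k p.2, f (Fin.cons p.1 j) := by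
  rw [sum_sigma']
  refine sum_bij' (fun j _ => ⟨(j 0, ∑ i, Fin.tail j i), Fin.tail j⟩)
    (fun x _ => Fin.cons x.1.1 x.2) ?_ ?_ ?_ ?_ ?_
  · intro j hj
    simpa [Nat.mem_antidiagonalTuple, Fin.sum_univ_succ, Fin.tail] using hj
  · rintro ⟨⟨a, b⟩, j⟩ hx
    simp only [mem_sigma, HasAntidiagonal.mem_antidiagonal, Nat.mem_antidiagonalTuple] at hx
    simp [Nat.mem_antidiagonalTuple, Fin.sum_univ_succ, hx.1, hx.2]
  · simp
  · rintro ⟨⟨a, b⟩, j⟩ hx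
    simp only [mem_sigma, HasAntidiagonal.mem_antidiagonal, Nat.mem_antidiagonalTuple] at hx
    simp [hx.2]
  · simp

section ComplexHilbertSpace

variable {H : Type*} [NormedAddCommGroup H] [InnerProductSpace ℂ H] {n : ℕ}

lemma HasExpansion.clm_apply {T : ℝ → H →L[ℂ] H} {Q : ℕ → H →L[ℂ] H} {f : ℝ → H} {c : ℕ → H}
    (hT : HasExpansion n T Q) (hf : HasExpansion n f c) :
    HasExpansion n (fun ε => T ε (f ε)) fun m => ∑ p ∈ antidiagonal m, Q p.1 (c p.2) :=
  hT.bilin (ContinuousLinearMap.restrictScalarsL ℂ H H ℝ ℝ) hf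

lemma HasExpansion.inner {f g : ℝ → H} {c d : ℕ → H}
    (hf : HasExpansion n f c) (hg : HasExpansion n g d) :
    HasExpansion n (fun ε => ⟪f ε, g ε⟫_ℂ) fun m => ∑ p ∈ antidiagonal m, ⟪c p.1, d p.2⟫_ℂ :=
  hf.bilin (isBoundedBilinearMap_inner (𝕜 := ℂ) (E := H)).toContinuousLinearMap hg

lemma HasExpansion.smul {f : ℝ → ℂ} {g : ℝ → H} {c : ℕ → ℂ} {d : ℕ → H}
    (hf : HasExpansion n f c) (hg : HasExpansion n g d) :
    HasExpansion n (fun ε => f ε • g ε) fun m => ∑ p ∈ antidiagonal m, c p.1 • d p.2 :=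
  hf.bilin (ContinuousLinearMap.lsmul ℝ ℂ) hg

lemma HasExpansion.mul {f g : ℝ → ℂ} {c d : ℕ → ℂ}
    (hf : HasExpansion n f c) (hg : HasExpansion n g d) :
    HasExpansion n (fun ε => f ε * g ε) fun m => ∑ p ∈ antidiagonal m, c p.1 * d p.2 :=
  hf.smul hg

/-- A fixed point `f = c 0 + (T - Q 0) f` inherits an expansion from `T`. -/
lemma HasExpansion.of_fixed_point {T : ℝ → H →L[ℂ] H} {Q : ℕ → H →L[ℂ] H} {f : ℝ → H}
    {c : ℕ → H} (hT : ∀ n, HasExpansion n T Q) (hf : f =O[𝓝[>] (0 : ℝ)] fun _ => (1 : ℝ))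
    (hfix : ∀ᶠ ε in 𝓝[>] (0 : ℝ), f ε = c 0 + (T ε - Q 0) (f ε))
    (hc : ∀ m, c (m + 1) = ∑ p ∈ antidiagonal m, Q (p.1 + 1) (c p.2)) (n : ℕ) :
    HasExpansion n f c := by
  induction n with
  | zero => exact HasExpansion.zero_iff.2 hf
  | succ n ih =>
    rw [HasExpansion.succ_iff]
    refine ((HasExpansion.succ_iff.1 (hT (n + 1))).clm_apply ih).congr ?_ fun m => (hc m).symm
    filter_upwards [hfix] with ε hε
    rw [_root_.smul_apply]
    congr 1
    exact eq_sub_of_add_eq' hε.symm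

/-- If `α` is the formal inverse square root of the expansion of `s⁻²`, then `s` has the
expansion `α`. -/
lemma HasExpansion.of_mul_inv_sq {s : ℝ → ℝ} {N : ℝ → ℂ} {α ν : ℕ → ℂ}
    (hs : Tendsto s (𝓝[>] 0) (𝓝 1))
    (hN : HasExpansion (n + 1) N ν) (hNs : ∀ᶠ ε in 𝓝[>] (0 : ℝ), N ε * (s ε : ℂ) ^ 2 = 1)
    (hα0 : α 0 = 1)
    (hα : ∀ ℓ, ∑ p ∈ antidiagonal ℓ, α p.1 * ∑ q ∈ antidiagonal p.2, α q.1 * ν q.2 =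
      if ℓ = 0 then 1 else 0) :
    HasExpansion (n + 1) (fun ε => (s ε : ℂ)) α := by
  set A : ℝ → ℂ := fun ε => ∑ i ∈ range (n + 1), ε ^ i • α i with hA
  have hAexp : HasExpansion (n + 1) A α := HasExpansion.polynomial _ _
  have hsC : Tendsto (fun ε => (s ε : ℂ)) (𝓝[>] 0) (𝓝 1) := by
    exact_mod_cast (Complex.continuous_ofReal.tendsto 1).comp hs
  have hprod : (fun ε => A ε * (A ε * N ε) - 1) =O[𝓝[>] (0 : ℝ)] fun ε => ε ^ (n + 1) := by
    refine IsBigO.congr_left (hAexp.mul (hAexp.mul hN)) fun ε => ?_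
    simp only [hα]
    simp
  have hsum : Tendsto (fun ε => A ε + s ε) (𝓝[>] 0) (𝓝 2) := by
    have := hAexp.tendsto.add hsC
    rw [hα0] at this
    convert this using 2
    norm_num
  have hinv : (fun ε => (s ε : ℂ) ^ 2 * (A ε + s ε)⁻¹) =O[𝓝[>] (0 : ℝ)] fun _ => (1 : ℝ) :=
    ((hsC.pow 2).mul (hsum.inv₀ two_ne_zero)).isBigO_one ℝ
  have hne : ∀ᶠ ε in 𝓝[>] (0 : ℝ), A ε + s ε ≠ 0 := hsum.eventually_ne two_ne_zero
  have hdiff : (fun ε => A ε - s ε) =O[𝓝[>] (0 : ℝ)] fun ε => ε ^ (n + 1) := by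
    refine (hprod.mul hinv).congr' ?_ (by simp)
    filter_upwards [hne, hNs] with ε h1 h2
    field_simp
    linear_combination (A ε) ^ 2 * h2
  exact hdiff.neg_left.congr_left fun ε => by simp [hA]

end ComplexHilbertSpace

/-- The normalization recursion says that `α` is the formal inverse square root of the
series with coefficients `∑ r ∈ antidiagonal n, b r.1 r.2`. -/
lemma sum_antidiagonal_of_normalization_recursion {α : ℕ → ℂ} {b : ℕ → ℕ → ℂ}
    (hα0 : α 0 = 1) (hb : b 0 0 = 1)
    (hα : ∀ ℓ : ℕ, 1 ≤ ℓ → α ℓ = -(1 / 2) *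
      ∑ j ∈ (Nat.antidiagonalTuple 4 ℓ).filter (fun j => j 0 < ℓ ∧ j 1 < ℓ),
        α (j 0) * α (j 1) * b (j 2) (j 3)) (ℓ : ℕ) :
    ∑ p ∈ antidiagonal ℓ, α p.1 * ∑ q ∈ antidiagonal p.2, α q.1 *
      ∑ r ∈ antidiagonal q.2, b r.1 r.2 = if ℓ = 0 then 1 else 0 := by
  have htuple : ∑ p ∈ antidiagonal ℓ, α p.1 * ∑ q ∈ antidiagonal p.2, α q.1 *
      ∑ r ∈ antidiagonal q.2, b r.1 r.2 =
      ∑ j ∈ Nat.antidiagonalTuple 4 ℓ, α (j 0) * α (j 1) * b (j 2) (j 3) := by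
    simp [Nat.sum_antidiagonalTuple_succ, Nat.antidiagonalTuple_one, mul_sum, mul_assoc]
  rw [htuple]
  rcases Nat.eq_zero_or_pos ℓ with rfl | hℓ
  · simp [Nat.antidiagonalTuple_zero_right, hα0, hb]
  have hcompl : (Nat.antidiagonalTuple 4 ℓ).filter (fun j => ¬(j 0 < ℓ ∧ j 1 < ℓ)) =
      {![ℓ, 0, 0, 0], ![0, ℓ, 0, 0]} := by
    ext j
    simp only [mem_filter, Nat.mem_antidiagonalTuple, Fin.sum_univ_four, mem_insert,
      mem_singleton, funext_iff, Fin.forall_fin_succ]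
    simp
    omega
  have hne : (![ℓ, 0, 0, 0] : Fin 4 → ℕ) ≠ ![0, ℓ, 0, 0] := fun h => by
    have := congrFun h 0
    simp at this
    omega
  rw [← sum_filter_add_sum_filter_not _ (fun j => j 0 < ℓ ∧ j 1 < ℓ), hcompl, sum_pair hne,
    if_neg hℓ.ne']
  simp [hα0, hb]
  linear_combination 2 * hα ℓ hℓ

/-- Asymptotic expansion of a wave function from the asymptotic expansion of the associated
rank-one projections (Theorem B.1 of the paper): if the rank-one projections
`P(ε) = ⟨χ(ε),·⟩χ(ε)` admit an operator-norm asymptotic expansion with coefficients `P_ℓ`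
to every order, `P₀ = ⟨χ₀,·⟩χ₀`, and `χ_ℓ = Σ_j α_j χ̃_{ℓ−j}` with `χ̃_ℓ` the composition
sums `Σ P_{j₁}⋯P_{j_ν}χ₀` and `α_ℓ` the recursively defined normalization scalars, then for
every order `a` and all small `ε` there is a phase `θ` with
`‖θ·χ(ε) − Σ_{ℓ=0}^a ε^ℓ χ_ℓ‖ ≤ C̃(a) ε^{a+1}`. -/
theorem wavefunction_expansion_from_projection_expansion
    {H : Type*} [NormedAddCommGroup H] [InnerProductSpace ℂ H] [CompleteSpace H]
    (χ : ℝ → H) (hχnorm : ∀ ε : ℝ, 0 < ε → ‖χ ε‖ = 1)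
    (χ₀ : H) (hχ₀ : ‖χ₀‖ = 1)
    (Pc : ℕ → H →L[ℂ] H)
    (hP0 : Pc 0 = (innerSL ℂ χ₀).smulRight χ₀)
    (hexp : ∀ a : ℕ, ∃ C : ℝ, 0 < C ∧ ∃ εa : ℝ, 0 < εa ∧
      ∀ ε : ℝ, 0 < ε → ε ≤ εa →
        ‖(innerSL ℂ (χ ε)).smulRight (χ ε) -
            ∑ ℓ ∈ Finset.range (a + 1), ε ^ ℓ • Pc ℓ‖ ≤ C * ε ^ (a + 1))
    (χt : ℕ → H) (hχt0 : χt 0 = χ₀)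
    (hχt : ∀ ℓ : ℕ, 1 ≤ ℓ →
      χt ℓ = ∑ ν ∈ Finset.Icc 1 ℓ,
        ∑ c ∈ Finset.univ.filter (fun c : Composition ℓ => c.length = ν),
          ((c.blocks.map Pc).prod) χ₀)
    (α : ℕ → ℂ) (hα0 : α 0 = 1)
    (hα : ∀ ℓ : ℕ, 1 ≤ ℓ →
      α ℓ = -(1 / 2) *
        ∑ j ∈ (Finset.Nat.antidiagonalTuple 4 ℓ).filter
            (fun j => j 0 < ℓ ∧ j 1 < ℓ),
          α (j 0) * α (j 1) * ⟪χt (j 2), χt (j 3)⟫_ℂ)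
    (χc : ℕ → H)
    (hχc : ∀ ℓ : ℕ, χc ℓ = ∑ j ∈ Finset.range (ℓ + 1), α j • χt (ℓ - j)) :
    ∀ a : ℕ, ∃ C : ℝ, 0 < C ∧ ∃ εa : ℝ, 0 < εa ∧
      ∀ ε : ℝ, 0 < ε → ε ≤ εa →
        ∃ θ : ℂ, ‖θ‖ = 1 ∧
          ‖θ • χ ε - ∑ ℓ ∈ Finset.range (a + 1), (ε : ℂ) ^ ℓ • χc ℓ‖ ≤ C * ε ^ (a + 1) := by
  intro a
  set P : ℝ → H →L[ℂ] H := fun ε => (innerSL ℂ (χ ε)).smulRight (χ ε) with hP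
  set z : ℝ → ℂ := fun ε => ⟪χ₀, χ ε⟫_ℂ with hz
  set ψ : ℝ → H := fun ε => (z ε)⁻¹ • χ ε with hψ
  have hpos : ∀ᶠ ε in 𝓝[>] (0 : ℝ), 0 < ε := self_mem_nhdsWithin
  have hPexp : ∀ n, HasExpansion n P Pc := by
    intro n
    refine HasExpansion.of_succ ?_
    obtain ⟨C, -, ε₀, hε₀, h⟩ := hexp n
    refine IsBigO.of_bound C ?_
    filter_upwards [Ioc_mem_nhdsGT hε₀] with ε hε
    simpa [abs_of_pos hε.1] using h ε hε.1 hε.2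
  have hznorm : Tendsto (fun ε => ‖z ε‖) (𝓝[>] 0) (𝓝 1) := by
    have h : Tendsto (fun ε => ‖P ε χ₀‖) (𝓝[>] 0) (𝓝 ‖Pc 0 χ₀‖) :=
      (((ContinuousLinearMap.apply ℂ H χ₀).continuous.tendsto _).comp
        (hPexp 1).tendsto).norm
    have h0 : ‖Pc 0 χ₀‖ = 1 := by simp [hP0, hχ₀, inner_self_eq_norm_sq_to_K]
    rw [h0] at h
    refine h.congr' ?_
    filter_upwards [hpos] with ε hε
    simp [hP, hz, norm_smul, hχnorm ε hε, norm_inner_symm]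
  have hz0 : ∀ᶠ ε in 𝓝[>] (0 : ℝ), z ε ≠ 0 := by
    filter_upwards [hznorm.eventually_ne one_ne_zero] with ε hε
    exact norm_ne_zero_iff.1 hε
  have hψbdd : ψ =O[𝓝[>] (0 : ℝ)] fun _ => (1 : ℝ) := by
    refine ((hznorm.inv₀ one_ne_zero).isBigO_one ℝ).norm_left.congr' ?_ .rfl |>.of_norm_left
    filter_upwards [hpos] with ε hε
    simp [hψ, norm_smul, hχnorm ε hε]
  have hfix : ∀ᶠ ε in 𝓝[>] (0 : ℝ), ψ ε = χt 0 + (P ε - Pc 0) (ψ ε) := by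
    filter_upwards [hpos, hz0] with ε hε hzε
    have h1 : P ε (ψ ε) = ψ ε := by
      simp [hP, hψ, inner_self_eq_norm_sq_to_K, hχnorm ε hε]
    have h2 : Pc 0 (ψ ε) = χ₀ := by
      have : (z ε)⁻¹ * ⟪χ₀, χ ε⟫_ℂ = 1 := inv_mul_cancel₀ hzε
      simp [hP0, hψ, smul_smul, this]
    rw [_root_.sub_apply, h1, h2, hχt0]
    abel
  have hχt_sum : ∀ ℓ, χt ℓ = (∑ c : Composition ℓ, (c.blocks.map Pc).prod) χ₀ := by
    intro ℓ
    rcases Nat.eq_zero_or_pos ℓ with rfl | hℓ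
    · have hnil : ∀ c : Composition 0, c.blocks = [] := fun c => c.blocks_eq_nil.2 rfl
      simp [hχt0, hnil, composition_card]
    · rw [hχt ℓ hℓ, _root_.sum_apply]
      exact sum_fiberwise_of_maps_to
        (fun c _ => mem_Icc.2 ⟨c.length_pos_iff.2 hℓ, c.length_le⟩) _
  have hrec : ∀ m, χt (m + 1) = ∑ p ∈ antidiagonal m, Pc (p.1 + 1) (χt p.2) := by
    intro m
    rw [hχt_sum, Composition.sum_prod_map_blocks_succ, _root_.sum_apply]
    exact sum_congr rfl fun p _ => by rw [hχt_sum p.2]; rfl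
  have hψexp := HasExpansion.of_fixed_point hPexp hψbdd hfix hrec (a + 1)
  have hzexp : HasExpansion (a + 1) (fun ε => ((‖z ε‖ : ℝ) : ℂ)) α := by
    refine HasExpansion.of_mul_inv_sq hznorm (hψexp.inner hψexp) ?_ hα0
      (sum_antidiagonal_of_normalization_recursion (b := fun i j => ⟪χt i, χt j⟫_ℂ) hα0 ?_ hα)
    · filter_upwards [hpos, hz0] with ε hε hzε
      have : ((‖z ε‖ : ℝ) : ℂ) ≠ 0 := by simpa using hzε
      rw [inner_self_eq_norm_sq_to_K, hψ, norm_smul, hχnorm ε hε, norm_inv]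
      simp [this]
    · simp [hχt0, inner_self_eq_norm_sq_to_K, hχ₀]
  have hmain : HasExpansion (a + 1) (fun ε => ((‖z ε‖ : ℝ) : ℂ) • ψ ε) χc :=
    (hzexp.smul hψexp).congr .rfl fun ℓ => by
      rw [hχc, Nat.sum_antidiagonal_eq_sum_range_succ (fun i j => α i • χt j)]
  obtain ⟨C, hC, hbound⟩ := IsBigO.exists_pos hmain
  obtain ⟨δ, hδ, hsub⟩ := mem_nhdsGT_iff_exists_Ioc_subset.1 (hbound.bound.and (hpos.and hz0))
  refine ⟨C, hC, δ, hδ, fun ε hε hεδ => ?_⟩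
  obtain ⟨hle, -, hzε⟩ := hsub ⟨hε, hεδ⟩
  refine ⟨(‖z ε‖ : ℝ) * (z ε)⁻¹, ?_, ?_⟩
  · simp [hzε]
  · rw [Real.norm_of_nonneg (by positivity)] at hle
    convert hle using 3
    · exact mul_smul _ _ _
    · refine sum_congr rfl fun ℓ _ => ?_
      rw [← Complex.ofReal_pow, Complex.coe_smul]
end

section
/- Let V be a complex vector space, let (P_j)_{j≥1} be linear operators on V, let χ₀ ∈ V, and let α : ℕ₀ → ℂ be any sequence with α₀ = 1. Define χ̃₀ := χ₀ and, for ℓ ≥ 1, χ̃_ℓ := Σ_{ν=1}^{ℓ} Σ_{(j₁,…,j_ν) a composition of ℓ} P_{j₁}P_{j₂}⋯P_{j_ν}χ₀, and set χ_ℓ := Σ_{j=0}^{ℓ} α_j·χ̃_{ℓ−j}. Then χ_0 = χ₀ and, for every ℓ ≥ 1, χ_ℓ = Σ_{k=1}^{ℓ} P_k χ_{ℓ−k} + α_ℓ·χ₀. -/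
/-- A sum over the compositions of `n > 0` can be organised according to the first block. -/
theorem Composition.sum_blocks_eq_sum_cons {M : Type*} [AddCommMonoid M] {n : ℕ} (hn : 0 < n)
    (f : List ℕ → M) :
    ∑ c : Composition n, f c.blocks =
      ∑ k ∈ Finset.Icc 1 n, ∑ c : Composition (n - k), f (k :: c.blocks) := by
  rw [Finset.sum_sigma']
  symm
  refine Finset.sum_bij (fun x hx => ⟨x.1 :: x.2.blocks, ?_, ?_⟩) ?_ ?_ ?_ ?_
  · simp only [Finset.mem_sigma, Finset.mem_Icc, Finset.mem_univ, and_true] at hx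
    intro i hi
    rcases List.mem_cons.1 hi with rfl | hi
    · exact hx.1
    · exact x.2.blocks_pos hi
  · simp only [Finset.mem_sigma, Finset.mem_Icc, Finset.mem_univ, and_true] at hx
    rw [List.sum_cons, x.2.blocks_sum]
    omega
  · simp
  · rintro ⟨k, c⟩ _ ⟨k', c'⟩ _ heq
    obtain ⟨rfl, h⟩ := List.cons.inj (congrArg Composition.blocks heq)
    exact congrArg (Sigma.mk k) (Composition.ext h)
  · rintro ⟨_ | ⟨k, l⟩, hpos, hsum⟩ -
    · simp at hsum
      omega
    · have hk := hpos (i := k) (by simp)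
      rw [List.sum_cons] at hsum
      refine ⟨⟨k, l, fun hi => hpos (List.mem_cons_of_mem _ hi), by omega⟩, ?_, rfl⟩
      simp only [Finset.mem_sigma, Finset.mem_Icc, Finset.mem_univ, and_true]
      omega
  · simp

/-- The coefficients `χ_ℓ = Σ_{j=0}^ℓ α_j χ̃_{ℓ−j}`, with `χ̃_ℓ` given by the sum over
compositions `(j₁,…,j_ν)` of `ℓ` of `P_{j₁}⋯P_{j_ν}χ₀`, satisfy the recursion
`χ_ℓ = Σ_{k=1}^ℓ P_k χ_{ℓ−k} + α_ℓ·χ₀` for any scalars `α` with `α₀ = 1`. -/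
theorem composition_sum_eq_recursion
    {V : Type*} [AddCommGroup V] [Module ℂ V]
    (P : ℕ → Module.End ℂ V) (χ₀ : V) (α : ℕ → ℂ) (hα0 : α 0 = 1)
    (χt : ℕ → V) (hχt0 : χt 0 = χ₀)
    (hχt : ∀ ℓ : ℕ, 1 ≤ ℓ →
      χt ℓ = ∑ ν ∈ Finset.Icc 1 ℓ,
        ∑ c ∈ Finset.univ.filter (fun c : Composition ℓ => c.length = ν),
          ((c.blocks.map P).prod) χ₀)
    (χ : ℕ → V) (hχ : ∀ ℓ : ℕ, χ ℓ = ∑ j ∈ Finset.range (ℓ + 1), α j • χt (ℓ - j)) :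
    χ 0 = χ₀ ∧
      ∀ ℓ : ℕ, 1 ≤ ℓ → χ ℓ = (∑ k ∈ Finset.Icc 1 ℓ, P k (χ (ℓ - k))) + α ℓ • χ₀ := by
  have hsum (ℓ : ℕ) : χt ℓ = ∑ c : Composition ℓ, ((c.blocks.map P).prod) χ₀ := by
    rcases Nat.eq_zero_or_pos ℓ with rfl | hℓ
    · have hb (c : Composition 0) : c.blocks = [] := c.blocks_eq_nil.2 rfl
      simp [hχt0, hb, composition_card]
    · rw [hχt ℓ hℓ]
      exact Finset.sum_fiberwise_of_maps_to
        (fun c _ => Finset.mem_Icc.2 ⟨c.length_pos_iff.2 hℓ, c.length_le⟩) _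
  have hrec (ℓ : ℕ) (hℓ : 0 < ℓ) : χt ℓ = ∑ k ∈ Finset.Icc 1 ℓ, P k (χt (ℓ - k)) := by
    rw [hsum, Composition.sum_blocks_eq_sum_cons hℓ fun l => (l.map P).prod χ₀]
    simp [hsum]
  refine ⟨by simp [hχ, hα0, hχt0], fun ℓ _ => ?_⟩
  rw [hχ ℓ, Finset.sum_range_succ, Nat.sub_self, hχt0]
  congr 1
  calc ∑ j ∈ Finset.range ℓ, α j • χt (ℓ - j)
      = ∑ j ∈ Finset.range ℓ, ∑ k ∈ Finset.Icc 1 (ℓ - j), α j • P k (χt (ℓ - j - k)) := by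
        refine Finset.sum_congr rfl fun j hj => ?_
        rw [hrec _ (Nat.sub_pos_of_lt (Finset.mem_range.1 hj)), Finset.smul_sum]
    _ = ∑ k ∈ Finset.Icc 1 ℓ, ∑ j ∈ Finset.range (ℓ - k + 1), α j • P k (χt (ℓ - j - k)) := by
        refine Finset.sum_comm' fun j k => ?_
        simp only [Finset.mem_range, Finset.mem_Icc]
        omega
    _ = ∑ k ∈ Finset.Icc 1 ℓ, P k (χ (ℓ - k)) := by
        simp only [hχ, map_sum, map_smul, Nat.sub_right_comm]
end

section
/- Let H be a complex Hilbert space and let f, g ∈ H be unit vectors. Let P_f := ⟨f, ·⟩·f and P_g := ⟨g, ·⟩·g be the orthogonal projections onto ℂ·f and ℂ·g. Then there exists θ ∈ ℂ with |θ| = 1 such that ‖θ·f − g‖ ≤ √2 · ‖P_f − P_g‖_op. -/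
/-- For unit vectors, the squared distance from `f` to its projection onto `ℂ·g`. -/
theorem norm_sub_inner_smul_sq_of_norm_eq_one
    {H : Type*} [NormedAddCommGroup H] [InnerProductSpace ℂ H]
    {f g : H} (hf : ‖f‖ = 1) (hg : ‖g‖ = 1) :
    ‖f - inner ℂ g f • g‖ ^ 2 = 1 - ‖inner ℂ f g‖ ^ 2 := by
  have h : RCLike.re (inner ℂ f (inner ℂ g f • g)) = ‖inner ℂ f g‖ ^ 2 := by
    rw [inner_smul_right, inner_mul_symm_re_eq_norm, norm_mul, norm_inner_symm g f, sq]
  rw [norm_sub_sq (𝕜 := ℂ), h, norm_smul, hf, hg, norm_inner_symm g f]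
  ring

/-- The phase of `⟪f, g⟫` rotates `f` so that its inner product with `g` becomes nonnegative. -/
theorem exists_phase_norm_smul_sub_sq
    {H : Type*} [NormedAddCommGroup H] [InnerProductSpace ℂ H]
    {f g : H} (hf : ‖f‖ = 1) (hg : ‖g‖ = 1) :
    ∃ θ : ℂ, ‖θ‖ = 1 ∧ ‖θ • f - g‖ ^ 2 = 2 - 2 * ‖inner ℂ f g‖ := by
  set z : ℂ := inner ℂ f g with hz
  have hθ : ‖Complex.exp (z.arg * Complex.I)‖ = 1 := Complex.norm_exp_ofReal_mul_I _
  refine ⟨Complex.exp (z.arg * Complex.I), hθ, ?_⟩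
  generalize hw : Complex.exp (z.arg * Complex.I) = θ at hθ
  have hzθ : (‖z‖ : ℂ) * θ = z := hw ▸ Complex.norm_mul_exp_arg_mul_I z
  have hre : RCLike.re (inner ℂ (θ • f) g) = ‖z‖ := by
    have h : inner ℂ (θ • f) g = (‖z‖ : ℂ) := by
      rw [inner_smul_left, ← hz]
      nth_rewrite 1 [← hzθ]
      rw [mul_left_comm, Complex.conj_mul', hθ]
      simp
    rw [h]
    exact Complex.ofReal_re _
  rw [norm_sub_sq (𝕜 := ℂ), hre, norm_smul, hθ, hf, hg]
  ring


/-- For unit vectors `f, g` in a complex Hilbert space, there is a phase `θ` with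
`‖θ·f − g‖ ≤ √2 ‖P_f − P_g‖_op`, where `P_f, P_g` are the rank-one orthogonal
projections onto `ℂ·f` and `ℂ·g`. -/
theorem vector_phase_close_of_projections_close
    {H : Type*} [NormedAddCommGroup H] [InnerProductSpace ℂ H] [CompleteSpace H]
    (f g : H) (hf : ‖f‖ = 1) (hg : ‖g‖ = 1) :
    ∃ θ : ℂ, ‖θ‖ = 1 ∧
      ‖θ • f - g‖ ≤
        Real.sqrt 2 * ‖(innerSL ℂ f).smulRight f - (innerSL ℂ g).smulRight g‖ := by
  obtain ⟨θ, hθ, hdist⟩ := exists_phase_norm_smul_sub_sq hf hg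
  refine ⟨θ, hθ, ?_⟩
  have hop : ‖f - inner ℂ g f • g‖ ≤
      ‖(innerSL ℂ f).smulRight f - (innerSL ℂ g).smulRight g‖ := by
    simpa [hf] using
      ((innerSL ℂ f).smulRight f - (innerSL ℂ g).smulRight g).le_opNorm f
  refine le_trans ?_ (mul_le_mul_of_nonneg_left hop (Real.sqrt_nonneg 2))
  have hc : ‖inner ℂ f g‖ ≤ 1 := by simpa [hf, hg] using norm_inner_le_norm (𝕜 := ℂ) f g
  refine (sq_le_sq₀ (by positivity) (by positivity)).1 ?_
  rw [mul_pow, Real.sq_sqrt zero_le_two, norm_sub_inner_smul_sq_of_norm_eq_one hf hg, hdist]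
  nlinarith [norm_nonneg (inner ℂ f g)]
end
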